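/- arXiv:1701.00531 — 2 statements merged into one kernel-verified Lean document; each statement's English description precedes it below -/
import Mathlib

section
/- Let g' = 3k for some odd integer k ≥ 1. Then the maximal degree among data sets of type B of genus 2g' equals 3g' = 9k: there exists a data set of type B of genus 2g' and degree 3g', and every data set of type B of genus 2g' has degree n ≤ 3g'. -/
/-- A data set of type B (degree `n`), as in Parlak–Stukow:
conditions (D1), (D2), (D3B), (D4B). -/
structure DataSetB where
  n : ℤ
  g0 : ℤ
  a : ℤ
  b : ℤ
  m : ℕ
  c : Fin m → ℤ
  ni : Fin m → ℤ
  /-- (D1): `n > 1` is odd -/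
  n_gt_one : 1 < n
  n_odd : Odd n
  /-- (D1): each `nᵢ > 1` -/
  ni_gt_one : ∀ i, 1 < ni i
  /-- (D1): each `nᵢ` divides `n` -/
  ni_dvd : ∀ i, ni i ∣ n
  /-- (D2) -/
  gcd_a : Int.gcd a n = 1
  gcd_b : Int.gcd b n = 1
  gcd_c : ∀ i, Int.gcd (c i) (ni i) = 1
  /-- (D3B): `g₀ ≥ 0` -/
  g0_nonneg : 0 ≤ g0
  /-- (D3B): `b − a = ab mod n` -/
  D3B : b - a ≡ a * b [ZMOD n]
  /-- (D4B): `a + b + Σᵢ (n/nᵢ)·cᵢ = 0 mod n` -/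
  D4B : a + b + ∑ i, (n / ni i) * c i ≡ 0 [ZMOD n]

/-- The genus of a type B data set: `g = 2g₀·n + Σᵢ (n/nᵢ)(nᵢ − 1)`. -/
def DataSetB.genus (D : DataSetB) : ℤ :=
  2 * D.g0 * D.n + ∑ i, (D.n / D.ni i) * (D.ni i - 1)

/-- Every cone point of a type B data set of degree `n` contributes at least `2n/3` to the genus. -/
theorem DataSetB.two_mul_n_le_three_mul (D : DataSetB) (i : Fin D.m) :
    2 * D.n ≤ 3 * ((D.n / D.ni i) * (D.ni i - 1)) := by
  obtain ⟨q, hq⟩ := D.ni_dvd i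
  have h1 := D.ni_gt_one i
  have hn := D.n_gt_one
  have hdiv : D.n / D.ni i = q := by
    rw [hq]
    exact Int.mul_ediv_cancel_left q (by omega)
  have hodd : Odd (D.ni i) := (Int.odd_mul.mp (hq ▸ D.n_odd)).1
  have h3 : 3 ≤ D.ni i := by
    obtain ⟨t, ht⟩ := hodd
    omega
  have hq0 : 0 < q := by
    by_contra! h
    nlinarith
  rw [hdiv]
  nlinarith

/-- A type B data set of positive genus `g` has degree at most `3g/2`. -/
theorem DataSetB.two_mul_n_le_three_mul_genus (D : DataSetB) (hg : 0 < D.genus) :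
    2 * D.n ≤ 3 * D.genus := by
  have hn := D.n_gt_one
  have hterm (i : Fin D.m) : 0 ≤ (D.n / D.ni i) * (D.ni i - 1) := by
    linarith [D.two_mul_n_le_three_mul i]
  have hsum : 0 ≤ ∑ i, (D.n / D.ni i) * (D.ni i - 1) :=
    Finset.sum_nonneg fun i _ => hterm i
  unfold DataSetB.genus at *
  rcases D.g0_nonneg.eq_or_lt with h0 | h0
  · rw [← h0] at hg ⊢
    have hne : (∑ i, (D.n / D.ni i) * (D.ni i - 1)) ≠ 0 := by
      intro h
      simp [h] at hg
    obtain ⟨i, hi, -⟩ := Finset.exists_ne_zero_of_sum_ne_zero hne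
    have hle := Finset.single_le_sum (fun j _ => hterm j) hi
    linarith [D.two_mul_n_le_three_mul i]
  · nlinarith

/-- The type B data set `(9k, 0, (2 + 3k, -2 - 6k); (1, 3))` for odd `k ≥ 1`. -/
def DataSetB.ofOdd (k : ℤ) (hk : 1 ≤ k) (hkodd : Odd k) : DataSetB where
  n := 3 * (3 * k)
  g0 := 0
  a := 2 + 3 * k
  b := -2 - 6 * k
  m := 1
  c := fun _ => 1
  ni := fun _ => 3
  n_gt_one := by omega
  n_odd := by
    obtain ⟨j, rfl⟩ := hkodd
    exact ⟨9 * j + 4, by ring⟩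
  ni_gt_one := by simp
  ni_dvd := fun _ => ⟨3 * k, rfl⟩
  gcd_a := by
    obtain ⟨j, rfl⟩ := hkodd
    rw [← Int.isCoprime_iff_gcd_eq_one]
    have h3 : IsCoprime (2 + 3 * (2 * j + 1)) 3 := ⟨-1, 2 * j + 2, by ring⟩
    exact h3.mul_right (h3.mul_right ⟨-j, 1 + 3 * j, by ring⟩)
  gcd_b := by
    obtain ⟨j, rfl⟩ := hkodd
    rw [← Int.isCoprime_iff_gcd_eq_one]
    have h3 : IsCoprime (-2 - 6 * (2 * j + 1)) 3 := ⟨1, 4 * j + 3, by ring⟩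
    exact h3.mul_right (h3.mul_right ⟨j, 1 + 6 * j, by ring⟩)
  gcd_c := by simp
  g0_nonneg := le_rfl
  D3B := Int.modEq_iff_dvd.mpr ⟨-1 - 2 * k, by ring⟩
  D4B := by
    have hdiv : 3 * (3 * k) / 3 = 3 * k := by omega
    rw [Fin.sum_univ_one, hdiv]
    exact Int.modEq_iff_dvd.mpr ⟨0, by ring⟩

theorem DataSetB.genus_ofOdd (k : ℤ) (hk : 1 ≤ k) (hkodd : Odd k) :
    (DataSetB.ofOdd k hk hkodd).genus = 2 * (3 * k) := by
  have hdiv : 3 * (3 * k) / 3 = 3 * k := by omega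
  change 2 * 0 * (3 * (3 * k)) + ∑ _i : Fin 1, 3 * (3 * k) / 3 * (3 - 1) = 2 * (3 * k)
  rw [Fin.sum_univ_one, hdiv]
  ring

/-- For `g' = 3k` with `k ≥ 1` odd, the maximal degree among type B data sets
of genus `2g'` is `3g' = 9k`. -/
theorem typeB_max_degree_three_k (k : ℤ) (hk : 1 ≤ k) (hkodd : Odd k) :
    (∃ D : DataSetB, D.genus = 2 * (3 * k) ∧ D.n = 3 * (3 * k)) ∧
      ∀ D : DataSetB, D.genus = 2 * (3 * k) → D.n ≤ 3 * (3 * k) := by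
  refine ⟨⟨DataSetB.ofOdd k hk hkodd, DataSetB.genus_ofOdd k hk hkodd, rfl⟩, fun D hD => ?_⟩
  have := D.two_mul_n_le_three_mul_genus (by omega)
  omega
end

section
/- Let n ≥ 3 be an odd integer with n ≢ 0 (mod 3). (1) If g' ≥ (n−3)(n−1)/2 and g' ≥ 1, then there exists a primary data set of type B of degree n and genus 2g'. (2) If g' = (n−3)(n−1)/2 − 1, or if 0 < g' < (n−1)/2, then there is no primary data set of type B of degree n and genus 2g'. -/
/-- The genus of a primary type B data set is `2g₀n + m(n - 1)`. -/
theorem DataSetB.genus_of_primary (D : DataSetB) (h : ∀ i, D.ni i = D.n) :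
    D.genus = 2 * D.g0 * D.n + D.m * (D.n - 1) := by
  have hn : D.n ≠ 0 := by have := D.n_gt_one; omega
  simp [DataSetB.genus, h, Int.ediv_self hn]
  ring

/-- Given a unit `u` modulo `n` that balances `a + b` when `m` is odd, and `a + b = 0` when `m`
is even, the residues `cᵢ = ±u` with alternating signs complete `(a, b)` to a primary type B
data set. -/
theorem exists_primary_of_alternating (n g0 a b u : ℤ) (m : ℕ) (hn : 1 < n) (hodd : Odd n)
    (hg0 : 0 ≤ g0) (ha : IsCoprime a n) (hb : IsCoprime b n) (hu : IsCoprime u n)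
    (hab : b - a ≡ a * b [ZMOD n])
    (hsum : a + b + u * (if Even m then 0 else 1) ≡ 0 [ZMOD n]) :
    ∃ D : DataSetB, (∀ i, D.ni i = D.n) ∧ D.n = n ∧ D.g0 = g0 ∧ D.m = m := by
  refine ⟨⟨n, g0, a, b, m, fun i => u * (-1) ^ (i : ℕ), fun _ => n, hn, hodd, fun _ => hn,
    fun _ => dvd_rfl, Int.isCoprime_iff_gcd_eq_one.mp ha, Int.isCoprime_iff_gcd_eq_one.mp hb,
    fun i => Int.isCoprime_iff_gcd_eq_one.mp ?_, hg0, hab, ?_⟩, fun _ => rfl, rfl, rfl, rfl⟩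
  · rcases neg_one_pow_eq_or ℤ (i : ℕ) with h | h
    · simpa [h] using hu
    · simpa [h] using hu.neg_left
  · rw [Int.ediv_self (by omega)]
    simp only [one_mul]
    rw [← Finset.mul_sum, Fin.sum_univ_eq_sum_range (fun i => (-1 : ℤ) ^ i), neg_one_geom_sum]
    exact hsum

/-- If `3 ∤ n`, every pair `(g₀, m)` is realized by a primary type B data set of degree `n`. -/
theorem exists_primary_of_not_three_dvd (n g0 : ℤ) (m : ℕ) (hn : 1 < n) (hodd : Odd n)
    (h3 : ¬ (3 : ℤ) ∣ n) (hg0 : 0 ≤ g0) :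
    ∃ D : DataSetB, (∀ i, D.ni i = D.n) ∧ D.n = n ∧ D.g0 = g0 ∧ D.m = m := by
  obtain ⟨k, rfl⟩ := hodd
  by_cases hm : Even m
  · have h2 : IsCoprime (2 : ℤ) (2 * k + 1) := ⟨-k, 1, by ring⟩
    refine exists_primary_of_alternating _ g0 2 (-2) 1 m hn ⟨k, rfl⟩ hg0 h2 h2.neg_left
      isCoprime_one_left (by norm_num) (by simp [hm])
  · obtain ⟨x, y, hxy⟩ := (Int.prime_three.coprime_iff_not_dvd).mpr h3
    have hu : IsCoprime (k + 2) (2 * k + 1) := ⟨2 * x, y - x, by linear_combination hxy⟩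
    refine exists_primary_of_alternating _ g0 (k + 1) 1 (-(k + 2)) m hn ⟨k, rfl⟩ hg0
      ⟨2, -1, by ring⟩ isCoprime_one_left hu.neg_left ?_ ?_
    · exact Int.modEq_iff_dvd.mpr ⟨1, by ring⟩
    · rw [if_neg hm]
      exact Int.modEq_iff_dvd.mpr ⟨0, by ring⟩

/-- Every integer `g ≥ 2k(k - 1)` is a nonnegative combination of `2k + 1` and `k`. -/
theorem exists_nonneg_combination (k g : ℤ) (hk : 0 < k) (hg : 2 * k * (k - 1) ≤ g) :
    ∃ (s : ℤ) (m : ℕ), 0 ≤ s ∧ g = s * (2 * k + 1) + m * k := by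
  have hr0 := Int.emod_nonneg g hk.ne'
  have hrk := Int.emod_lt_of_pos g hk
  have hq : 2 * (k - 1) ≤ g / k := (Int.le_ediv_iff_mul_le hk).mpr (by linarith)
  have hqr := Int.mul_ediv_add_emod g k
  refine ⟨g % k, (g / k - 2 * (g % k)).toNat, hr0, ?_⟩
  rw [Int.toNat_of_nonneg (by omega)]
  linear_combination -hqr

/-- The Frobenius number `2k(k - 1) - 1` is not a nonnegative combination of `2k + 1` and `k`. -/
theorem combination_ne_frobenius (k s m : ℤ) (hk : 0 < k) (hs : 0 ≤ s) (hm : 0 ≤ m) :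
    s * (2 * k + 1) + m * k ≠ 2 * k * (k - 1) - 1 := by
  intro h
  have hle : k ≤ s + 1 :=
    Int.le_of_dvd (by omega) ⟨2 * k - 2 - 2 * s - m, by linear_combination h⟩
  nlinarith

/-- No integer strictly between `0` and `k` is a nonnegative combination of `2k + 1` and `k`. -/
theorem le_combination_of_pos (k s m : ℤ) (hk : 0 < k) (hs : 0 ≤ s) (hm : 0 ≤ m)
    (hpos : 0 < s * (2 * k + 1) + m * k) : k ≤ s * (2 * k + 1) + m * k := by
  rcases hs.eq_or_lt with rfl | hs
  · rcases hm.eq_or_lt with rfl | hm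
    · simp at hpos
    · nlinarith
  · nlinarith

/-- Theorem 5.2(1): for odd `n ≥ 3` with `n ≢ 0 (mod 3)`, a primary
(all `nᵢ = n`) type B data set of degree `n` and genus `2g'` exists if
`g' ≥ (n−3)(n−1)/2` and `g' ≥ 1`, and does not exist if
`g' = (n−3)(n−1)/2 − 1` or `0 < g' < (n−1)/2`. -/
theorem primary_typeB_n_not_div_three (n : ℤ) (hn : 3 ≤ n) (hodd : Odd n)
    (h3 : ¬ (3 : ℤ) ∣ n) (g' : ℤ) :
    ((1 ≤ g' ∧ (n - 3) * (n - 1) / 2 ≤ g') →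
      ∃ D : DataSetB, (∀ i, D.ni i = D.n) ∧ D.n = n ∧ D.genus = 2 * g') ∧
    ((g' = (n - 3) * (n - 1) / 2 - 1 ∨ (0 < g' ∧ g' < (n - 1) / 2)) →
      ¬ ∃ D : DataSetB, (∀ i, D.ni i = D.n) ∧ D.n = n ∧ D.genus = 2 * g') := by
  obtain ⟨k, rfl⟩ := hodd
  have hk : 0 < k := by omega
  have hfrob : (2 * k + 1 - 3) * (2 * k + 1 - 1) / 2 = 2 * k * (k - 1) :=
    Int.ediv_eq_of_eq_mul_left two_ne_zero (by ring)
  have hhalf : (2 * k + 1 - 1) / 2 = k := by omega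
  rw [hfrob, hhalf]
  constructor
  · rintro ⟨-, hg⟩
    obtain ⟨s, m, hs, rfl⟩ := exists_nonneg_combination k g' hk hg
    obtain ⟨D, hD, hDn, rfl, rfl⟩ :=
      exists_primary_of_not_three_dvd (2 * k + 1) s m (by omega) ⟨k, rfl⟩ h3 hs
    refine ⟨D, hD, hDn, ?_⟩
    rw [D.genus_of_primary hD, hDn]
    ring
  · rintro hg ⟨D, hD, hDn, hgenus⟩
    rw [D.genus_of_primary hD, hDn] at hgenus
    have hg' : g' = D.g0 * (2 * k + 1) + D.m * k := by linarith
    have hm : (0 : ℤ) ≤ D.m := by positivity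
    rcases hg with hg | ⟨hpos, hlt⟩
    · exact combination_ne_frobenius k D.g0 D.m hk D.g0_nonneg hm (hg'.symm.trans hg)
    · exact (le_combination_of_pos k D.g0 D.m hk D.g0_nonneg hm (hg' ▸ hpos)).not_gt (hg' ▸ hlt)
end
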